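/- L¹-bound for the jump at the first exit time of a ball: Let X be a Banach space, let M : [0,∞) × Ω → X be a càdlàg martingale, let λ > 0, and define τ := inf{ t ≥ 0 : ‖M_t‖ ≥ λ } (with inf ∅ = ∞). Then for every t ≥ 0, E[ ‖ΔM_τ‖ · 1_{τ ≤ t} ] ≤ 2 · E‖M_t‖, where ΔM_τ(ω) := M_{τ(ω)}(ω) − lim_{s↑τ(ω)} M_s(ω) for τ(ω) > 0 and ΔM_τ(ω) := M_0(ω) for τ(ω) = 0. -/

import Mathlib

open MeasureTheory Filter
open scoped NNReal ENNReal

/-- A function `f : [0,∞) → X` is càdlàg: it is right-continuous and has left limits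
at every positive time. -/
def CadlagPath {X : Type*} [TopologicalSpace X] (f : ℝ≥0 → X) : Prop :=
  (∀ t : ℝ≥0, ContinuousWithinAt f (Set.Ici t) t) ∧
    ∀ t : ℝ≥0, 0 < t → ∃ l : X, Tendsto f (nhdsWithin t (Set.Iio t)) (nhds l)

/-- The filtration `ℱ` is right-continuous. -/
def RightContinuousFiltration {Ω : Type*} {m : MeasurableSpace Ω}
    (ℱ : MeasureTheory.Filtration ℝ≥0 m) : Prop :=
  ∀ t : ℝ≥0, (ℱ t : MeasurableSpace Ω) = ⨅ (s : ℝ≥0) (_ : t < s), (ℱ s : MeasurableSpace Ω)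

/-- The filtration `ℱ` contains all `μ`-null sets. -/
def CompleteFiltration {Ω : Type*} {m : MeasurableSpace Ω} (μ : Measure Ω)
    (ℱ : MeasureTheory.Filtration ℝ≥0 m) : Prop :=
  ∀ s : Set Ω, μ s = 0 → MeasurableSet[ℱ 0] s

open Set TopologicalSpace
open scoped Topology

section OptionalTimes

variable {Ω : Type*} {m : MeasurableSpace Ω}

/-- An optional time of `ℱ`: a random time `σ` with `{σ < s} ∈ ℱ s` for all `s`. -/
def IsOptionalTime (ℱ : Filtration ℝ≥0 m) (σ : Ω → ℝ≥0∞) : Prop :=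
  ∀ s : ℝ≥0, MeasurableSet[ℱ s] {ω | σ ω < s}

theorem IsOptionalTime.measurable {ℱ : Filtration ℝ≥0 m} {σ : Ω → ℝ≥0∞}
    (hσ : IsOptionalTime ℱ σ) : Measurable σ := by
  refine measurable_of_Iio fun a => ?_
  have : σ ⁻¹' Iio a = ⋃ n : ℕ, ⋃ (_ : (denseSeq ℝ≥0 n : ℝ≥0∞) < a),
      {ω | σ ω < denseSeq ℝ≥0 n} := by
    ext ω
    simp only [mem_preimage, mem_Iio, mem_iUnion, mem_ofPred_eq, exists_prop]
    refine ⟨fun h => ?_, fun ⟨n, h₁, h₂⟩ => h₂.trans h₁⟩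
    obtain ⟨p, hp, hpa⟩ := ENNReal.lt_iff_exists_nnreal_btwn.1 h
    obtain ⟨q, hq, hqa⟩ := ENNReal.lt_iff_exists_nnreal_btwn.1 hpa
    obtain ⟨_, ⟨n, rfl⟩, hn⟩ :=
      (denseRange_denseSeq ℝ≥0).exists_between (ENNReal.coe_lt_coe.1 hq)
    exact ⟨n, (ENNReal.coe_lt_coe.2 hn.2).trans hqa, hp.trans (ENNReal.coe_lt_coe.2 hn.1)⟩
  rw [this]
  exact .iUnion fun n => .iUnion fun _ => ℱ.le _ _ (hσ _)

theorem IsOptionalTime.iSup {ℱ : Filtration ℝ≥0 m} {σ : ℕ → Ω → ℝ≥0∞}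
    (hσ : ∀ n, IsOptionalTime ℱ (σ n)) : IsOptionalTime ℱ fun ω => ⨆ n, σ n ω := by
  intro s
  have : {ω | ⨆ n, σ n ω < s} = ⋃ k : ℕ, ⋃ (_ : denseSeq ℝ≥0 k < s),
      ⋂ n, {ω | σ n ω < denseSeq ℝ≥0 k} := by
    ext ω
    simp only [mem_iUnion, mem_ofPred_eq, exists_prop, mem_iInter]
    refine ⟨fun h => ?_, fun ⟨k, h₁, h₂⟩ =>
      (iSup_le fun n => (h₂ n).le).trans_lt (ENNReal.coe_lt_coe.2 h₁)⟩
    obtain ⟨p, hp, hps⟩ := ENNReal.lt_iff_exists_nnreal_btwn.1 h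
    obtain ⟨_, ⟨k, rfl⟩, hk⟩ :=
      (denseRange_denseSeq ℝ≥0).exists_between (ENNReal.coe_lt_coe.1 hps)
    exact ⟨k, hk.2, fun n =>
      (le_iSup (fun n => σ n ω) n).trans_lt (hp.trans (ENNReal.coe_lt_coe.2 hk.1))⟩
  rw [this]
  exact .iUnion fun k => .iUnion fun hk => .iInter fun n => ℱ.mono hk.le _ (hσ n _)

/-- The first time, along a fixed countable dense set, that `Y` exceeds `c` strictly after `σ`. -/
noncomputable def exceedanceTimeAfter (Y : ℝ≥0 → Ω → ℝ) (c : ℝ) (σ : Ω → ℝ≥0∞) (ω : Ω) : ℝ≥0∞ :=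
  ⨅ (n : ℕ) (_ : σ ω < denseSeq ℝ≥0 n ∧ c < Y (denseSeq ℝ≥0 n) ω), (denseSeq ℝ≥0 n : ℝ≥0∞)

theorem exceedanceTimeAfter_lt_iff {Y : ℝ≥0 → Ω → ℝ} {c : ℝ} {σ : Ω → ℝ≥0∞} {ω : Ω}
    {a : ℝ≥0∞} : exceedanceTimeAfter Y c σ ω < a ↔
      ∃ n, (σ ω < denseSeq ℝ≥0 n ∧ c < Y (denseSeq ℝ≥0 n) ω) ∧ (denseSeq ℝ≥0 n : ℝ≥0∞) < a := by
  simp only [exceedanceTimeAfter, iInf_lt_iff, exists_prop]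

theorem le_exceedanceTimeAfter (Y : ℝ≥0 → Ω → ℝ) (c : ℝ) (σ : Ω → ℝ≥0∞) (ω : Ω) :
    σ ω ≤ exceedanceTimeAfter Y c σ ω :=
  le_iInf fun _ => le_iInf fun h => h.1.le

theorem IsOptionalTime.exceedanceTimeAfter {ℱ : Filtration ℝ≥0 m} {Y : ℝ≥0 → Ω → ℝ}
    (hY : ∀ t, Measurable[ℱ t] (Y t)) (c : ℝ) {σ : Ω → ℝ≥0∞} (hσ : IsOptionalTime ℱ σ) :
    IsOptionalTime ℱ (exceedanceTimeAfter Y c σ) := by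
  intro s
  have : {ω | _root_.exceedanceTimeAfter Y c σ ω < s} = ⋃ n : ℕ, ⋃ (_ : denseSeq ℝ≥0 n < s),
      ({ω | σ ω < denseSeq ℝ≥0 n} ∩ Y (denseSeq ℝ≥0 n) ⁻¹' Ioi c) := by
    ext ω
    simp only [mem_ofPred_eq, exceedanceTimeAfter_lt_iff, ENNReal.coe_lt_coe, mem_iUnion,
      exists_prop, mem_inter_iff, mem_preimage, mem_Ioi]
    exact exists_congr fun _ => and_comm
  rw [this]
  exact .iUnion fun n => .iUnion fun hn =>
    ℱ.mono hn.le _ ((hσ _).inter (hY _ measurableSet_Ioi))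

theorem exceedanceTimeAfter_le_of_lt {Y : ℝ≥0 → Ω → ℝ} {c : ℝ} {σ : Ω → ℝ≥0∞} {ω : Ω}
    {s : ℝ≥0} (hYc : ContinuousWithinAt (fun t => Y t ω) (Ici s) s) (hs : σ ω ≤ s)
    (hcs : c < Y s ω) : exceedanceTimeAfter Y c σ ω ≤ s := by
  refine le_of_forall_gt fun a ha => ?_
  obtain ⟨u, hu, hus⟩ := mem_nhdsGE_iff_exists_Ico_subset.1 (hYc (Ioi_mem_nhds hcs))
  obtain ⟨p, hp, hpa⟩ := ENNReal.lt_iff_exists_nnreal_btwn.1 ha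
  obtain ⟨_, ⟨n, rfl⟩, hn⟩ := (denseRange_denseSeq ℝ≥0).exists_between
    (lt_min (ENNReal.coe_lt_coe.1 hp) hu)
  rw [exceedanceTimeAfter_lt_iff]
  exact ⟨n, ⟨hs.trans_lt (ENNReal.coe_lt_coe.2 hn.1),
    hus ⟨hn.1.le, hn.2.trans_le (min_le_right _ _)⟩⟩,
    (ENNReal.coe_lt_coe.2 (hn.2.trans_le (min_le_left _ _))).trans hpa⟩

theorem lt_exceedanceTimeAfter {Y : ℝ≥0 → Ω → ℝ} {c : ℝ} {σ : Ω → ℝ≥0∞} {ω : Ω}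
    {s : ℝ≥0} (hYc : ContinuousWithinAt (fun t => Y t ω) (Ici s) s) (hs : σ ω = s)
    (hcs : Y s ω < c) : σ ω < exceedanceTimeAfter Y c σ ω := by
  obtain ⟨u, hu, hus⟩ := mem_nhdsGE_iff_exists_Ico_subset.1 (hYc (Iio_mem_nhds hcs))
  rw [hs]
  refine (ENNReal.coe_lt_coe.2 hu).trans_le (le_iInf fun n => le_iInf fun h => ?_)
  rw [hs, ENNReal.coe_lt_coe] at h
  by_contra! hlt
  exact lt_asymm h.2 (hus ⟨h.1.le, ENNReal.coe_lt_coe.1 hlt⟩)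

/-- A family of random times stable under countable suprema has an a.e. maximal element. -/
theorem exists_ae_maximal_of_iSup_mem {μ : Measure Ω} [IsFiniteMeasure μ]
    {S : Set (Ω → ℝ≥0∞)} (hne : S.Nonempty) (hmeas : ∀ σ ∈ S, Measurable σ)
    (hsup : ∀ σ : ℕ → Ω → ℝ≥0∞, (∀ n, σ n ∈ S) → (fun ω => ⨆ n, σ n ω) ∈ S) :
    ∃ σ ∈ S, ∀ σ' ∈ S, σ ≤ σ' → σ =ᵐ[μ] σ' := by
  let F : (Ω → ℝ≥0∞) → ℝ≥0∞ := fun σ => ∫⁻ ω, (1 + σ ω)⁻¹ ∂μ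
  obtain ⟨u, -, hu, huS⟩ := exists_seq_tendsto_sInf (hne.image F) (OrderBot.bddBelow _)
  choose σ hσS hσu using huS
  refine ⟨_, hsup σ hσS, fun σ' hσ' hle => ?_⟩
  have hfin : F σ' ≠ ∞ := by
    refine ne_top_of_le_ne_top (measure_ne_top μ univ) ?_
    calc F σ' ≤ ∫⁻ _, 1 ∂μ := lintegral_mono fun ω => by simp
      _ = μ univ := by simp
  have hmin : F (fun ω => ⨆ n, σ n ω) ≤ F σ' := by
    refine (ge_of_tendsto' hu fun n => ?_).trans (sInf_le (mem_image_of_mem F hσ'))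
    rw [← hσu n]
    refine lintegral_mono fun ω => ENNReal.inv_le_inv.2 ?_
    gcongr
    exact le_iSup (fun n => σ n ω) n
  have hae := ae_eq_of_ae_le_of_lintegral_le (μ := μ)
    (f := fun ω => (1 + σ' ω)⁻¹) (g := fun ω => (1 + ⨆ n, σ n ω)⁻¹)
    (.of_forall fun ω => ENNReal.inv_le_inv.2 (by gcongr; exact hle ω)) hfin
    ((hmeas _ (hsup σ hσS)).const_add 1).inv.aemeasurable hmin
  filter_upwards [hae] with ω hω
  exact ((ENNReal.add_right_inj ENNReal.one_ne_top).1 (inv_injective hω)).symm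

theorem le_of_hitting_eq {Y : ℝ≥0 → Ω → ℝ} {c : ℝ} {ω : Ω} {s : ℝ≥0}
    (hYc : ContinuousWithinAt (fun t => Y t ω) (Ici s) s)
    (hs : ⨅ (t : ℝ≥0) (_ : c ≤ Y t ω), (t : ℝ≥0∞) = s) : c ≤ Y s ω := by
  by_contra! hlt
  obtain ⟨u, hu, hus⟩ := mem_nhdsGE_iff_exists_Ico_subset.1 (hYc (Iio_mem_nhds hlt))
  have : (u : ℝ≥0∞) ≤ s := by
    rw [← hs]
    refine le_iInf fun t => le_iInf fun ht => ?_
    by_contra! htu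
    have hst : (s : ℝ≥0∞) ≤ t := hs ▸ iInf₂_le t ht
    exact ht.not_gt (hus ⟨ENNReal.coe_le_coe.1 hst, ENNReal.coe_lt_coe.1 htu⟩)
  exact this.not_gt (ENNReal.coe_lt_coe.2 hu)

/-- The hitting time of `[c, ∞)` by a right-continuous adapted process is a.e. equal to an optional
time. -/
theorem exists_isOptionalTime_ae_eq_hitting {μ : Measure Ω} [IsFiniteMeasure μ]
    {ℱ : Filtration ℝ≥0 m} {Y : ℝ≥0 → Ω → ℝ} (hY : ∀ t, Measurable[ℱ t] (Y t))
    (hYc : ∀ ω t, ContinuousWithinAt (fun t => Y t ω) (Ici t) t) {c : ℝ} {τ : Ω → ℝ≥0∞}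
    (hτ : ∀ ω, τ ω = ⨅ (t : ℝ≥0) (_ : c ≤ Y t ω), (t : ℝ≥0∞)) :
    ∃ σ, IsOptionalTime ℱ σ ∧ τ =ᵐ[μ] σ := by
  obtain ⟨σ, ⟨hσ, hστ⟩, hmax⟩ := exists_ae_maximal_of_iSup_mem (μ := μ)
    (S := {σ | IsOptionalTime ℱ σ ∧ σ ≤ τ}) ⟨0, fun s => by simp, fun ω => by simp⟩
    (fun σ hσ => hσ.1.measurable)
    (fun σ hσ => ⟨.iSup fun n => (hσ n).1, fun ω => iSup_le fun n => (hσ n).2 ω⟩)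
  refine ⟨σ, hσ, ?_⟩
  have hstep : ∀ᵐ ω ∂μ, ∀ n : ℕ, σ ω = exceedanceTimeAfter Y (c - 1 / (n + 1)) σ ω := by
    refine ae_all_iff.2 fun n => hmax _ ⟨hσ.exceedanceTimeAfter hY _, fun ω => ?_⟩
      (le_exceedanceTimeAfter Y _ σ)
    rcases eq_or_ne (τ ω) ∞ with h | h
    · simp [h]
    · lift τ ω to ℝ≥0 using h with s hs
      have hcs : c ≤ Y s ω := le_of_hitting_eq (hYc ω s) (by rw [← hτ, hs])
      refine exceedanceTimeAfter_le_of_lt (hYc ω s) (hs ▸ hστ ω) ?_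
      have : (0 : ℝ) < 1 / (n + 1) := by positivity
      linarith
  filter_upwards [hstep] with ω hω
  refine le_antisymm ?_ (hστ ω)
  rcases eq_or_ne (σ ω) ∞ with h | h
  · simp [h]
  obtain ⟨s, hs⟩ : ∃ s : ℝ≥0, ↑s = σ ω := ⟨_, ENNReal.coe_toNNReal h⟩
  rw [hτ, ← hs]
  refine iInf₂_le s ?_
  by_contra! hlt
  obtain ⟨n, hn⟩ := exists_nat_one_div_lt (sub_pos.2 hlt)
  exact (lt_exceedanceTimeAfter (hYc ω s) hs.symm (by linarith)).ne (hω n)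

end OptionalTimes

section MartingaleBound

variable {Ω : Type*} {m : MeasurableSpace Ω} {μ : Measure Ω}
  {X : Type*} [NormedAddCommGroup X] [NormedSpace ℝ X] [CompleteSpace X]
  {ℱ : Filtration ℝ≥0 m} {M : ℝ≥0 → Ω → X}

theorem MeasureTheory.Martingale.setLIntegral_enorm_le (hM : Martingale M ℱ μ) {u t : ℝ≥0}
    (hut : u ≤ t) {A : Set Ω} (hA : MeasurableSet[ℱ u] A) :
    ∫⁻ ω in A, ‖M u ω‖ₑ ∂μ ≤ ∫⁻ ω in A, ‖M t ω‖ₑ ∂μ := by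
  have hA' := ℱ.le u _ hA
  have hind : A.indicator (M u) =ᵐ[μ] μ[A.indicator (M t) | ℱ u] := by
    filter_upwards [condExp_indicator (hM.integrable t) hA, hM.2 u t hut] with ω h₁ h₂
    rw [h₁]
    simp only [indicator, h₂]
  have h := eLpNorm_condExp_le_eLpNorm (μ := μ) (m := ℱ u) (A.indicator (M t)) (le_refl 1)
  rw [← eLpNorm_congr_ae hind, eLpNorm_indicator_eq_eLpNorm_restrict hA',
    eLpNorm_indicator_eq_eLpNorm_restrict hA'] at h
  simpa only [eLpNorm_one_eq_lintegral_enorm] using h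

/-- Optional stopping: the value of a right-continuous martingale at an optional time `σ`, on
`{σ ≤ t}`, is bounded in `L¹` by its value at `t`. -/
theorem MeasureTheory.Martingale.setLIntegral_enorm_optionalTime_le (hM : Martingale M ℱ μ)
    (hMc : ∀ ω t, ContinuousWithinAt (fun t => M t ω) (Ici t) t) {σ : Ω → ℝ≥0∞}
    (hσ : IsOptionalTime ℱ σ) (t : ℝ≥0) :
    ∫⁻ ω in {ω | σ ω ≤ t}, ‖M (σ ω).toNNReal ω‖ₑ ∂μ ≤ ∫⁻ ω, ‖M t ω‖ₑ ∂μ := by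
  let v : ℕ → ℕ → ℝ≥0 := fun n k => k / (n + 1)
  let A : ℕ → ℕ → Set Ω := fun n k => {ω | σ ω < v n (k + 1)} \ {ω | σ ω < v n k}
  let g : ℕ → Ω → ℝ≥0∞ := fun n ω =>
    ∑' k, (A n k).indicator (fun ω => ‖M (min t (v n (k + 1))) ω‖ₑ) ω
  have hv : ∀ n, Monotone (v n) := fun n i j hij => by dsimp only [v]; gcongr
  have hAF : ∀ n k, MeasurableSet[ℱ (v n (k + 1))] (A n k) := fun n k =>
    (hσ _).diff (ℱ.mono (hv n k.le_succ) _ (hσ _))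
  have hA : ∀ n k, MeasurableSet (A n k) := fun n k => ℱ.le _ _ (hAF n k)
  have hAd : ∀ n, Pairwise (Function.onFun Disjoint (A n)) := fun n =>
    (pairwise_disjoint_on _).2 fun i j hij => by
      refine disjoint_left.2 fun ω ⟨(hi : σ ω < v n (i + 1)), _⟩ hj => hj.2 ?_
      exact hi.trans_le (ENNReal.coe_le_coe.2 (hv n hij))
  have hMm : ∀ s, Measurable fun ω => ‖M s ω‖ₑ := fun s =>
    ((hM.stronglyMeasurable s).mono (ℱ.le s)).enorm
  have hgm : ∀ n, Measurable (g n) := fun n =>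
    .tsum fun k => (hMm _).indicator (hA n k)
  have hgle : ∀ n, ∫⁻ ω, g n ω ∂μ ≤ ∫⁻ ω, ‖M t ω‖ₑ ∂μ := by
    intro n
    calc ∫⁻ ω, g n ω ∂μ = ∑' k, ∫⁻ ω in A n k, ‖M (min t (v n (k + 1))) ω‖ₑ ∂μ := by
          rw [lintegral_tsum fun k => ((hMm _).indicator (hA n k)).aemeasurable]
          exact tsum_congr fun k => lintegral_indicator (hA n k) _
      _ ≤ ∑' k, ∫⁻ ω in A n k, ‖M t ω‖ₑ ∂μ := by
          refine ENNReal.tsum_le_tsum fun k => ?_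
          rcases le_total t (v n (k + 1)) with h | h
          · rw [min_eq_left h]
          · rw [min_eq_right h]
            exact hM.setLIntegral_enorm_le h (hAF n k)
      _ = ∫⁻ ω in ⋃ k, A n k, ‖M t ω‖ₑ ∂μ := (lintegral_iUnion (hA n) (hAd n) _).symm
      _ ≤ ∫⁻ ω, ‖M t ω‖ₑ ∂μ := setLIntegral_le_lintegral _ _
  have hlim : ∀ ω, σ ω ≤ t → Tendsto (fun n => g n ω) atTop (𝓝 ‖M (σ ω).toNNReal ω‖ₑ) := by
    intro ω hω
    obtain ⟨s, hs⟩ : ∃ s : ℝ≥0, ↑s = σ ω :=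
      ⟨_, ENNReal.coe_toNNReal (ne_top_of_le_ne_top ENNReal.coe_ne_top hω)⟩
    have hst : s ≤ t := by rwa [← hs, ENNReal.coe_le_coe] at hω
    let r : ℕ → ℝ≥0 := fun n => min t (v n (⌊s * (n + 1)⌋₊ + 1))
    have hlo : ∀ n : ℕ, s < v n (⌊s * (n + 1)⌋₊ + 1) := fun n => by
      dsimp only [v]
      rw [lt_div_iff₀ (by positivity)]
      exact_mod_cast Nat.lt_floor_add_one _
    have hup : ∀ n : ℕ, v n ⌊s * (n + 1)⌋₊ ≤ s := fun n => by
      dsimp only [v]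
      rw [div_le_iff₀ (by positivity)]
      exact Nat.floor_le (by positivity)
    have hg : ∀ n, g n ω = ‖M (r n) ω‖ₑ := fun n => by
      have hmem : ω ∈ A n ⌊s * (n + 1)⌋₊ := by
        refine ⟨?_, ?_⟩
        · simpa only [mem_ofPred_eq, ← hs, ENNReal.coe_lt_coe] using hlo n
        · simpa only [mem_ofPred_eq, ← hs, ENNReal.coe_lt_coe, not_lt] using hup n
      dsimp only [g]
      rw [tsum_eq_single ⌊s * (n + 1)⌋₊ fun k hk => indicator_of_notMem
        (fun hk' => disjoint_left.1 (hAd n hk) hk' hmem) _, indicator_of_mem hmem]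
    have hr : Tendsto r atTop (𝓝[≥] s) := by
      refine tendsto_nhdsWithin_iff.2 ⟨?_, .of_forall fun n => le_min hst (hlo n).le⟩
      have h1 : Tendsto (fun n : ℕ => s + 1 / ((n : ℝ≥0) + 1)) atTop (𝓝 s) := by
        simpa using (tendsto_one_div_add_atTop_nhds_zero_nat (𝕜 := ℝ≥0)).const_add s
      refine tendsto_of_tendsto_of_tendsto_of_le_of_le tendsto_const_nhds h1
        (fun n => le_min hst (hlo n).le) fun n => (min_le_right _ _).trans ?_
      calc v n (⌊s * (n + 1)⌋₊ + 1) = v n ⌊s * (n + 1)⌋₊ + 1 / ((n : ℝ≥0) + 1) := by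
            dsimp only [v]; push_cast; rw [add_div]
        _ ≤ s + 1 / ((n : ℝ≥0) + 1) := by gcongr; exact hup n
    simp only [hg, ← hs, ENNReal.toNNReal_coe]
    exact ((hMc ω s).tendsto.comp hr).enorm
  have hσt : MeasurableSet {ω | σ ω ≤ t} := hσ.measurable measurableSet_Iic
  calc ∫⁻ ω in {ω | σ ω ≤ t}, ‖M (σ ω).toNNReal ω‖ₑ ∂μ
      = ∫⁻ ω in {ω | σ ω ≤ t}, liminf (fun n => g n ω) atTop ∂μ :=
        setLIntegral_congr_fun hσt fun ω hω => (hlim ω hω).liminf_eq.symm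
    _ ≤ ∫⁻ ω, liminf (fun n => g n ω) atTop ∂μ := setLIntegral_le_lintegral _ _
    _ ≤ liminf (fun n => ∫⁻ ω, g n ω ∂μ) atTop := lintegral_liminf_le hgm
    _ ≤ liminf (fun _ : ℕ => ∫⁻ ω, ‖M t ω‖ₑ ∂μ) atTop := liminf_le_liminf (.of_forall hgle)
    _ = ∫⁻ ω, ‖M t ω‖ₑ ∂μ := liminf_const _

end MartingaleBound

theorem CadlagPath.norm_leftLim_le {X : Type*} [NormedAddCommGroup X] {f : ℝ≥0 → X}
    (hf : CadlagPath f) {s : ℝ≥0} (hs : 0 < s) {c : ℝ} (hc : ∀ u < s, ‖f u‖ ≤ c) :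
    ‖Function.leftLim f s‖ ≤ c := by
  have : (𝓝[<] s).NeBot := nhdsLT_neBot_of_exists_lt ⟨0, hs⟩
  obtain ⟨l, hl⟩ := hf.2 s hs
  rw [leftLim_eq_of_tendsto hl]
  exact le_of_tendsto hl.norm (eventually_mem_nhdsWithin.mono hc)

/-- **`L¹`-bound for the jump at the first exit time of a ball.**
Let `M` be a càdlàg `X`-valued martingale, `λ > 0`, and
`τ = inf {t ≥ 0 : ‖M t‖ ≥ λ}` (with `inf ∅ = ∞`). Let `D` be the jump of `M` at `τ`
(`D ω = M 0 ω` if `τ ω = 0`, and `D ω = M_{τ ω} ω - lim_{s ↑ τ ω} M s ω` if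
`0 < τ ω < ∞`). Then for every `t ≥ 0`,
`E[‖D‖ · 1_{τ ≤ t}] ≤ 2 E‖M t‖`. -/
theorem jump_at_first_exit_time_L1_bound
    {Ω : Type*} {m : MeasurableSpace Ω} {μ : Measure Ω} [IsProbabilityMeasure μ]
    {X : Type*} [NormedAddCommGroup X] [NormedSpace ℝ X] [CompleteSpace X]
    (ℱ : Filtration ℝ≥0 m)
    (hright : RightContinuousFiltration ℱ) (hcompl : CompleteFiltration μ ℱ)
    (M : ℝ≥0 → Ω → X) (hM : Martingale M ℱ μ)
    (hMcadlag : ∀ ω, CadlagPath fun t => M t ω)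
    (lam : ℝ) (hlam : 0 < lam)
    (τ : Ω → ℝ≥0∞)
    (hτ : ∀ ω, τ ω = ⨅ (t : ℝ≥0) (_ : lam ≤ ‖M t ω‖), (t : ℝ≥0∞))
    (D : Ω → X)
    (hD0 : ∀ ω, τ ω = 0 → D ω = M 0 ω)
    (hDpos : ∀ (ω : Ω) (s : ℝ≥0), τ ω = (s : ℝ≥0∞) → 0 < s →
      D ω = M s ω - Function.leftLim (fun u => M u ω) s) :
    ∀ t : ℝ≥0,
      ∫⁻ ω in {ω | τ ω ≤ (t : ℝ≥0∞)}, (‖D ω‖₊ : ℝ≥0∞) ∂μ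
        ≤ 2 * ∫⁻ ω, (‖M t ω‖₊ : ℝ≥0∞) ∂μ := by
  intro t
  obtain ⟨σ, hσ, hτσ⟩ := exists_isOptionalTime_ae_eq_hitting (μ := μ)
    (fun s => ((hM.stronglyMeasurable s).norm).measurable)
    (fun ω s => ((hMcadlag ω).1 s).norm) hτ
  have hD : ∀ ω, τ ω ≤ t → ‖D ω‖ ≤ 2 * ‖M (τ ω).toNNReal ω‖ := by
    intro ω hω
    obtain ⟨s, hs⟩ : ∃ s : ℝ≥0, ↑s = τ ω :=
      ⟨_, ENNReal.coe_toNNReal (ne_top_of_le_ne_top ENNReal.coe_ne_top hω)⟩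
    have hls : lam ≤ ‖M s ω‖ := le_of_hitting_eq (Y := fun u ω => ‖M u ω‖)
      (((hMcadlag ω).1 s).norm) (by rw [← hτ, hs])
    rw [← hs, ENNReal.toNNReal_coe]
    rcases eq_zero_or_pos s with rfl | hpos
    · rw [hD0 ω (by rw [← hs, ENNReal.coe_zero])]
      linarith [norm_nonneg (M 0 ω)]
    · rw [hDpos ω s hs.symm hpos]
      have hleft := (hMcadlag ω).norm_leftLim_le hpos (c := lam) fun u hu => by
        by_contra! hlt
        have : τ ω ≤ u := hτ ω ▸ iInf₂_le u hlt.le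
        rw [← hs, ENNReal.coe_le_coe] at this
        exact this.not_gt hu
      linarith [norm_sub_le (M s ω) (Function.leftLim (fun u => M u ω) s)]
  have hset : {ω | τ ω ≤ t} =ᵐ[μ] {ω | σ ω ≤ t} := by
    refine eventuallyEq_set.2 (hτσ.mono fun ω hω => ?_)
    simp only [mem_ofPred_eq, hω]
  calc ∫⁻ ω in {ω | τ ω ≤ t}, (‖D ω‖₊ : ℝ≥0∞) ∂μ
      = ∫⁻ ω in {ω | σ ω ≤ t}, ‖D ω‖ₑ ∂μ := by rw [Measure.restrict_congr_set hset]; rfl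
    _ ≤ ∫⁻ ω in {ω | σ ω ≤ t}, 2 * ‖M (σ ω).toNNReal ω‖ₑ ∂μ := by
        refine lintegral_mono_ae ?_
        filter_upwards [ae_restrict_of_ae hτσ,
          ae_restrict_mem (hσ.measurable measurableSet_Iic)] with ω hω hωt
        have h := hD ω (hω ▸ hωt)
        rw [hω] at h
        rw [enorm_eq_nnnorm, enorm_eq_nnnorm]
        exact_mod_cast h
    _ = 2 * ∫⁻ ω in {ω | σ ω ≤ t}, ‖M (σ ω).toNNReal ω‖ₑ ∂μ :=
        lintegral_const_mul' _ _ ENNReal.ofNat_ne_top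
    _ ≤ 2 * ∫⁻ ω, (‖M t ω‖₊ : ℝ≥0∞) ∂μ := by
        refine mul_le_mul_right ?_ 2
        exact hM.setLIntegral_enorm_optionalTime_le (fun ω => (hMcadlag ω).1) hσ t
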